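/- arXiv:1402.1758 — 4 statements merged into one kernel-verified Lean document; each statement's English description precedes it below -/
import Mathlib

section
/- Let μ > 0 and let r : ℝ → ℝ³ be twice differentiable on an open interval I with r(t) ≠ 0 for all t ∈ I, satisfying the two-body equation of motion r''(t) = −(μ/‖r(t)‖³) · r(t) on I. Then the Laplace–Runge–Lenz vector A(t) = r'(t) × (r(t) × r'(t)) − μ · r(t)/‖r(t)‖ is constant on I. -/
/-- The three-dimensional cross product on `ℝ³` with the Euclidean norm. -/
noncomputable def cross3 (a b : EuclideanSpace ℝ (Fin 3)) : EuclideanSpace ℝ (Fin 3) :=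
  (WithLp.equiv 2 (Fin 3 → ℝ)).symm
    ![a 1 * b 2 - a 2 * b 1, a 2 * b 0 - a 0 * b 2, a 0 * b 1 - a 1 * b 0]

open scoped RealInnerProductSpace

/-- The Grassmann expansion of `v × (r × v)`. -/
lemma cross3_cross3_self (v r : EuclideanSpace ℝ (Fin 3)) :
    cross3 v (cross3 r v) = ⟪v, v⟫ • r - ⟪r, v⟫ • v := by
  ext i
  fin_cases i <;>
    simp [-inner_self_eq_norm_sq_to_K, cross3, PiLp.inner_apply, Fin.sum_univ_three] <;>
    ring

lemma HasDerivAt.norm_of_ne_zero {E : Type*} [NormedAddCommGroup E] [InnerProductSpace ℝ E]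
    {f : ℝ → E} {f' : E} {t : ℝ} (hf : HasDerivAt f f' t) (h0 : f t ≠ 0) :
    HasDerivAt (fun u => ‖f u‖) (⟪f t, f'⟫ / ‖f t‖) t := by
  have hn : ‖f t‖ ≠ 0 := norm_ne_zero_iff.mpr h0
  have h := hf.norm_sq.sqrt (pow_ne_zero 2 hn)
  simp only [Real.sqrt_sq (norm_nonneg _)] at h
  convert h using 1
  field_simp

/-- The derivative of the Laplace–Runge–Lenz vector vanishes along a motion whose acceleration is
given by the inverse-square law. -/
lemma hasDerivAt_lrl_zero {E : Type*} [NormedAddCommGroup E] [InnerProductSpace ℝ E]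
    {μ t : ℝ} {r v : ℝ → E} (h0 : r t ≠ 0) (hr : HasDerivAt r (v t) t)
    (hv : HasDerivAt v ((-(μ / ‖r t‖ ^ 3)) • r t) t) :
    HasDerivAt (fun u => ⟪v u, v u⟫ • r u - ⟪r u, v u⟫ • v u - (μ / ‖r u‖) • r u) 0 t := by
  have hn : ‖r t‖ ≠ 0 := norm_ne_zero_iff.mpr h0
  have h := (((hv.inner ℝ hv).smul hr).sub ((hr.inner ℝ hv).smul hv)).sub
    (((hasDerivAt_const t μ).div (hr.norm_of_ne_zero h0) hn).smul hr)
  refine h.congr_deriv ?_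
  simp only [real_inner_smul_left, real_inner_smul_right, real_inner_self_eq_norm_sq,
    real_inner_comm (r t) (v t), Pi.div_apply]
  match_scalars <;> field_simp <;> ring

/-- For a solution of the two-body equation of motion `r'' = -(μ/‖r‖³) r` on an open
interval `I`, the Laplace–Runge–Lenz vector `A = r' × (r × r') - μ r/‖r‖` is constant
on `I`. -/
theorem lrl_const_of_twoBody
    (μ : ℝ) (hμ : 0 < μ) (I : Set ℝ) (hI : IsOpen I) (hI' : I.OrdConnected)
    (r : ℝ → EuclideanSpace ℝ (Fin 3))
    (hr : ∀ t ∈ I, r t ≠ 0)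
    (hd1 : ∀ t ∈ I, DifferentiableAt ℝ r t)
    (hd2 : ∀ t ∈ I, DifferentiableAt ℝ (deriv r) t)
    (heq : ∀ t ∈ I, deriv (deriv r) t = (-(μ / ‖r t‖ ^ 3)) • r t) :
    ∀ s ∈ I, ∀ t ∈ I,
      cross3 (deriv r s) (cross3 (r s) (deriv r s)) - (μ / ‖r s‖) • r s =
        cross3 (deriv r t) (cross3 (r t) (deriv r t)) - (μ / ‖r t‖) • r t := by
  have hderiv : ∀ t ∈ I, HasDerivAt (fun u =>
      cross3 (deriv r u) (cross3 (r u) (deriv r u)) - (μ / ‖r u‖) • r u) 0 t := by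
    intro t ht
    simp only [cross3_cross3_self]
    exact hasDerivAt_lrl_zero (hr t ht) (hd1 t ht).hasDerivAt
      (heq t ht ▸ (hd2 t ht).hasDerivAt)
  intro s hs t ht
  exact hI.is_const_of_deriv_eq_zero hI'.isPreconnected
    (fun u hu => (hderiv u hu).differentiableAt.differentiableWithinAt)
    (fun u hu => (hderiv u hu).deriv) hs ht
end

section
/- Let μ ∈ ℝ and let r, v ∈ ℝ³ with r ≠ 0. Set H = r × v, E = ‖v‖²/2 − μ/‖r‖, and A = v × H − μ r/‖r‖. Then ‖A‖² = μ² + 2 E ‖H‖². In particular, when μ > 0 the orbital eccentricity e = ‖A‖/μ satisfies e = √(1 + 2‖H‖²E/μ²). -/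
open RealInnerProductSpace

theorem norm_sq_cross3 (a b : EuclideanSpace ℝ (Fin 3)) :
    ‖cross3 a b‖ ^ 2 = ‖a‖ ^ 2 * ‖b‖ ^ 2 - ⟪a, b⟫ ^ 2 := by
  simp only [EuclideanSpace.real_norm_sq_eq, PiLp.inner_apply, Fin.sum_univ_three, cross3]
  simp
  ring

theorem inner_cross3_self_right (a b : EuclideanSpace ℝ (Fin 3)) : ⟪a, cross3 b a⟫ = 0 := by
  simp only [PiLp.inner_apply, Fin.sum_univ_three, cross3]
  simp
  ring

theorem inner_cross3_cross3 (a b : EuclideanSpace ℝ (Fin 3)) :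
    ⟪cross3 b (cross3 a b), a⟫ = ‖cross3 a b‖ ^ 2 := by
  simp only [EuclideanSpace.real_norm_sq_eq, PiLp.inner_apply, Fin.sum_univ_three, cross3]
  simp
  ring

/-- With `H = r × v`, `E = ‖v‖²/2 - μ/‖r‖` and `A = v × H - μ r/‖r‖` one has
`‖A‖² = μ² + 2E‖H‖²`; in particular for `μ > 0` the eccentricity `e = ‖A‖/μ`
satisfies `e = √(1 + 2‖H‖²E/μ²)`. -/
theorem lrl_norm_sq_eq_and_eccentricity
    (μ : ℝ) (r v : EuclideanSpace ℝ (Fin 3)) (hr : r ≠ 0)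
    (H A : EuclideanSpace ℝ (Fin 3)) (E : ℝ)
    (hH : H = cross3 r v)
    (hE : E = ‖v‖ ^ 2 / 2 - μ / ‖r‖)
    (hA : A = cross3 v H - (μ / ‖r‖) • r) :
    ‖A‖ ^ 2 = μ ^ 2 + 2 * E * ‖H‖ ^ 2 ∧
      (0 < μ → ‖A‖ / μ = Real.sqrt (1 + 2 * ‖H‖ ^ 2 * E / μ ^ 2)) := by
  have hr' : ‖r‖ ≠ 0 := norm_ne_zero_iff.mpr hr
  have norm_sq : ‖A‖ ^ 2 = μ ^ 2 + 2 * E * ‖H‖ ^ 2 := by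
    have hcross : ‖cross3 v H‖ ^ 2 = ‖v‖ ^ 2 * ‖H‖ ^ 2 := by
      rw [norm_sq_cross3, hH, inner_cross3_self_right]
      ring
    have hinner : ⟪cross3 v H, r⟫ = ‖H‖ ^ 2 := by
      rw [hH, inner_cross3_cross3]
    rw [hA, norm_sub_sq_real, inner_smul_right, hcross, hinner, norm_smul, mul_pow,
      Real.norm_eq_abs, sq_abs, hE]
    field_simp
    ring
  refine ⟨norm_sq, fun hμ => ?_⟩
  rw [← Real.sqrt_sq (div_nonneg (norm_nonneg A) hμ.le), div_pow, norm_sq]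
  congr 1
  field_simp
end

section
/- Let μ > 0, let F : ℝ → ℝ³ be a perturbing acceleration, and let r : ℝ → ℝ³ be twice differentiable on an open interval I with r(t) ≠ 0, satisfying the perturbed equation of motion r''(t) = −(μ/‖r(t)‖³) r(t) + F(t) on I. With H(t) = r(t) × r'(t), the Laplace–Runge–Lenz vector A(t) = r'(t) × H(t) − μ r(t)/‖r(t)‖ satisfies A'(t) = F(t) × H(t) + r'(t) × (r(t) × F(t)) on I. -/
theorem hasDerivAt_euclidean_of_forall {ι : Type*} [Fintype ι] {f : ℝ → EuclideanSpace ℝ ι}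
    {f' : EuclideanSpace ℝ ι} {t : ℝ} (h : ∀ i, HasDerivAt (fun s => f s i) (f' i) t) :
    HasDerivAt f f' t :=
  (EuclideanSpace.equiv ι ℝ).symm.hasFDerivAt.comp_hasDerivAt t (hasDerivAt_pi.mpr h)

theorem hasDerivAt_euclidean_apply {ι : Type*} [Fintype ι] {f : ℝ → EuclideanSpace ℝ ι}
    {f' : EuclideanSpace ℝ ι} {t : ℝ} (h : HasDerivAt f f' t) (i : ι) :
    HasDerivAt (fun s => f s i) (f' i) t :=
  (EuclideanSpace.proj (𝕜 := ℝ) i).hasFDerivAt.comp_hasDerivAt t h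

theorem hasDerivAt_cross3 {f g : ℝ → EuclideanSpace ℝ (Fin 3)}
    {f' g' : EuclideanSpace ℝ (Fin 3)} {t : ℝ} (hf : HasDerivAt f f' t)
    (hg : HasDerivAt g g' t) :
    HasDerivAt (fun s => cross3 (f s) (g s)) (cross3 f' (g t) + cross3 (f t) g') t := by
  have key (i j : Fin 3) : HasDerivAt (fun s => f s i * g s j - f s j * g s i)
      ((f' i * g t j - f' j * g t i) + (f t i * g' j - f t j * g' i)) t := by
    refine (((hasDerivAt_euclidean_apply hf i).mul (hasDerivAt_euclidean_apply hg j)).sub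
      ((hasDerivAt_euclidean_apply hf j).mul (hasDerivAt_euclidean_apply hg i))).congr_deriv ?_
    ring
  refine hasDerivAt_euclidean_of_forall fun i => ?_
  fin_cases i
  · exact key 1 2
  · exact key 2 0
  · exact key 0 1

theorem hasDerivAt_norm {E : Type*} [NormedAddCommGroup E] [InnerProductSpace ℝ E]
    {f : ℝ → E} {f' : E} {t : ℝ} (hf : HasDerivAt f f' t) (h0 : f t ≠ 0) :
    HasDerivAt (fun s => ‖f s‖) (inner ℝ (f t) f' / ‖f t‖) t := by
  have h := hf.norm_sq.sqrt (pow_ne_zero 2 (norm_ne_zero_iff.mpr h0))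
  simp only [Real.sqrt_sq (norm_nonneg _)] at h
  convert h using 1
  rw [mul_div_mul_left _ _ two_ne_zero]

/-- For a solution of the perturbed two-body equation `r'' = -(μ/‖r‖³) r + F` on an
open interval `I`, with `H = r × r'`, the Laplace–Runge–Lenz vector
`A = r' × H - μ r/‖r‖` satisfies `A' = F × H + r' × (r × F)` on `I`. -/
theorem lrl_deriv_of_perturbed
    (μ : ℝ) (hμ : 0 < μ) (F : ℝ → EuclideanSpace ℝ (Fin 3))
    (I : Set ℝ) (hI : IsOpen I) (hI' : I.OrdConnected)
    (r : ℝ → EuclideanSpace ℝ (Fin 3))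
    (hr : ∀ t ∈ I, r t ≠ 0)
    (hd1 : ∀ t ∈ I, DifferentiableAt ℝ r t)
    (hd2 : ∀ t ∈ I, DifferentiableAt ℝ (deriv r) t)
    (heq : ∀ t ∈ I, deriv (deriv r) t = (-(μ / ‖r t‖ ^ 3)) • r t + F t)
    (H A : ℝ → EuclideanSpace ℝ (Fin 3))
    (hH : ∀ t, H t = cross3 (r t) (deriv r t))
    (hA : ∀ t, A t = cross3 (deriv r t) (H t) - (μ / ‖r t‖) • r t) :
    ∀ t ∈ I,
      HasDerivAt A (cross3 (F t) (H t) + cross3 (deriv r t) (cross3 (r t) (F t))) t := by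
  intro t ht
  have hv := (hd1 t ht).hasDerivAt
  have ha := (hd2 t ht).hasDerivAt
  rw [heq t ht] at ha
  have hρ : ‖r t‖ ≠ 0 := norm_ne_zero_iff.mpr (hr t ht)
  have hHd : HasDerivAt H _ t := (hasDerivAt_cross3 hv ha).congr_of_eventuallyEq (.of_forall hH)
  have hAd : HasDerivAt A _ t := ((hasDerivAt_cross3 ha hHd).sub
    (((hasDerivAt_const t μ).div (hasDerivAt_norm hv (hr t ht)) hρ).smul hv)).congr_of_eventuallyEq
      (.of_forall hA)
  convert hAd using 1
  have hsq : ‖r t‖ ^ 2 = r t 0 ^ 2 + r t 1 ^ 2 + r t 2 ^ 2 := by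
    rw [EuclideanSpace.real_norm_sq_eq, Fin.sum_univ_three]
  have hin : inner ℝ (r t) (deriv r t) =
      r t 0 * deriv r t 0 + r t 1 * deriv r t 1 + r t 2 * deriv r t 2 := by
    simp [PiLp.inner_apply, Fin.sum_univ_three, mul_comm]
  rw [hH, hin, Pi.div_apply]
  generalize ‖r t‖ = ρ at *
  ext i
  fin_cases i <;> simp [cross3] <;> field_simp
  · linear_combination (μ * deriv r t 0) * hsq
  · linear_combination (μ * deriv r t 1) * hsq
  · linear_combination (μ * deriv r t 2) * hsq
end

section
/- Let μ > 0, let F : ℝ → ℝ³ be a perturbing acceleration, and let r : ℝ → ℝ³ be twice differentiable on an open interval I with r(t) ≠ 0, satisfying the perturbed equation of motion r''(t) = −(μ/‖r(t)‖³) r(t) + F(t) on I. Suppose the energy per unit mass E(t) = ‖r'(t)‖²/2 − μ/‖r(t)‖ is negative on I, and define the osculating semi-major axis a(t) = −μ/(2E(t)). Then a is differentiable on I and a'(t) = (2 a(t)²/μ) ⟨r'(t), F(t)⟩. -/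
open RealInnerProductSpace

/-- The norm of a nonvanishing differentiable curve has derivative `⟪r, r'⟫ / ‖r‖`. -/
theorem HasDerivAt.norm_of_ne_zero_s11 {V : Type*} [NormedAddCommGroup V] [InnerProductSpace ℝ V]
    {r : ℝ → V} {v : V} {t : ℝ} (hr : HasDerivAt r v t) (h0 : r t ≠ 0) :
    HasDerivAt (fun s => ‖r s‖) (⟪r t, v⟫ / ‖r t‖) t := by
  have h := hr.norm_sq.sqrt (by simpa using h0)
  simp only [Real.sqrt_sq (norm_nonneg _)] at h
  convert h using 1
  exact (mul_div_mul_left _ _ two_ne_zero).symm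

/-- Along a solution of the perturbed two-body equation, the energy changes at the rate
`⟪r', F⟫`. -/
theorem hasDerivAt_energy_of_perturbed {V : Type*} [NormedAddCommGroup V]
    [InnerProductSpace ℝ V] {μ : ℝ} {r v : ℝ → V} {f : V} {t : ℝ} (h0 : r t ≠ 0)
    (hr : HasDerivAt r (v t) t) (hv : HasDerivAt v ((-(μ / ‖r t‖ ^ 3)) • r t + f) t) :
    HasDerivAt (fun s => ‖v s‖ ^ 2 / 2 - μ / ‖r s‖) ⟪v t, f⟫ t := by
  have hn : ‖r t‖ ≠ 0 := norm_ne_zero_iff.mpr h0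
  refine ((hv.norm_sq.div_const 2).sub
    ((hasDerivAt_const t μ).div (hr.norm_of_ne_zero_s11 h0) hn)).congr_deriv ?_
  rw [inner_add_right, real_inner_smul_right, real_inner_comm (r t) (v t)]
  field_simp
  ring

/-- For a solution of the perturbed two-body equation `r'' = -(μ/‖r‖³) r + F` on an
open interval `I` with negative energy `E = ‖r'‖²/2 - μ/‖r‖`, the osculating
semi-major axis `a = -μ/(2E)` is differentiable with `a' = (2a²/μ) ⟪r', F⟫` on `I`. -/
theorem semiMajorAxis_deriv_of_perturbed
    (μ : ℝ) (hμ : 0 < μ) (F : ℝ → EuclideanSpace ℝ (Fin 3))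
    (I : Set ℝ) (hI : IsOpen I) (hI' : I.OrdConnected)
    (r : ℝ → EuclideanSpace ℝ (Fin 3))
    (hr : ∀ t ∈ I, r t ≠ 0)
    (hd1 : ∀ t ∈ I, DifferentiableAt ℝ r t)
    (hd2 : ∀ t ∈ I, DifferentiableAt ℝ (deriv r) t)
    (heq : ∀ t ∈ I, deriv (deriv r) t = (-(μ / ‖r t‖ ^ 3)) • r t + F t)
    (E a : ℝ → ℝ)
    (hE : ∀ t, E t = ‖deriv r t‖ ^ 2 / 2 - μ / ‖r t‖)
    (hEneg : ∀ t ∈ I, E t < 0)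
    (ha : ∀ t, a t = -μ / (2 * E t)) :
    ∀ t ∈ I, HasDerivAt a (2 * (a t) ^ 2 / μ * ⟪deriv r t, F t⟫) t := by
  intro t ht
  have hv := (hd2 t ht).hasDerivAt
  rw [heq t ht] at hv
  have hEd : HasDerivAt E ⟪deriv r t, F t⟫ t := by
    rw [funext hE]
    exact hasDerivAt_energy_of_perturbed (hr t ht) (hd1 t ht).hasDerivAt hv
  have hE0 : E t ≠ 0 := (hEneg t ht).ne
  rw [ha t, funext ha]
  refine ((hasDerivAt_const t (-μ)).div (hEd.const_mul 2)
    (mul_ne_zero two_ne_zero hE0)).congr_deriv ?_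
  field_simp
  ring
end
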